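/- Let N ≥ 1 and let J be a set function on the Lebesgue-measurable subsets of ℝ^N with values in [0, +∞] which is submodular and translation invariant. Let R > 0, let E, E' be nonempty bounded subsets of ℝ^N with E + z ⊆ E' for every z ∈ ℝ^N with |z| ≤ R, and let h > 0. If F is a minimal minimizer of G ↦ J(G) + (1/h)∫_G d_E dx and F' is a minimal minimizer of G ↦ J(G) + (1/h)∫_G d_{E'} dx over Lebesgue-measurable sets, then |(F + z) \ F'| = 0 for every z ∈ ℝ^N with |z| ≤ R. The same holds for the respective maximal minimizers. -/

import Mathlib

open MeasureTheory Filter Set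
open scoped ENNReal

noncomputable def sdist {N : ℕ} (E : Set (EuclideanSpace ℝ (Fin N)))
    (x : EuclideanSpace ℝ (Fin N)) : ℝ :=
  Metric.infDist x E - Metric.infDist x Eᶜ

noncomputable def enInt {N : ℕ} (f : EuclideanSpace ℝ (Fin N) → ℝ)
    (F : Set (EuclideanSpace ℝ (Fin N))) : EReal :=
  ((∫⁻ x in F, ENNReal.ofReal (f x) ∂volume : ℝ≥0∞) : EReal) -
    ((∫⁻ x in F, ENNReal.ofReal (-f x) ∂volume : ℝ≥0∞) : EReal)

noncomputable def ene {N : ℕ} (J : Set (EuclideanSpace ℝ (Fin N)) → ℝ≥0∞)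
    (f : EuclideanSpace ℝ (Fin N) → ℝ) (F : Set (EuclideanSpace ℝ (Fin N))) : EReal :=
  (J F : EReal) + enInt f F

def IsMinimizer {N : ℕ} (𝓔 : Set (EuclideanSpace ℝ (Fin N)) → EReal)
    (F : Set (EuclideanSpace ℝ (Fin N))) : Prop :=
  MeasurableSet F ∧ ∀ G, MeasurableSet G → 𝓔 F ≤ 𝓔 G

def IsMinimalMinimizer {N : ℕ} (𝓔 : Set (EuclideanSpace ℝ (Fin N)) → EReal)
    (F : Set (EuclideanSpace ℝ (Fin N))) : Prop :=
  IsMinimizer 𝓔 F ∧ ∀ G, IsMinimizer 𝓔 G → volume (F \ G) = 0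

def IsMaximalMinimizer {N : ℕ} (𝓔 : Set (EuclideanSpace ℝ (Fin N)) → EReal)
    (F : Set (EuclideanSpace ℝ (Fin N))) : Prop :=
  IsMinimizer 𝓔 F ∧ ∀ G, IsMinimizer 𝓔 G → volume (G \ F) = 0

section Comparison

variable {N : ℕ}

local notation "X" => EuclideanSpace ℝ (Fin N)

theorem IsMinimizer.of_le {𝓔 : Set X → EReal} {F G : Set X} (hF : IsMinimizer 𝓔 F)
    (hG : MeasurableSet G) (hGF : 𝓔 G ≤ 𝓔 F) : IsMinimizer 𝓔 G :=
  ⟨hG, fun H hH => hGF.trans (hF.2 H hH)⟩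

theorem IsMinimizer.of_eq_top {𝓔 : Set X → EReal} {F G : Set X} (hF : IsMinimizer 𝓔 F)
    (hG : MeasurableSet G) (hF_top : 𝓔 F = ⊤) : IsMinimizer 𝓔 G :=
  hF.of_le hG (hF_top ▸ le_top)

theorem ene_eq_coe {J : Set X → ℝ≥0∞} {f : X → ℝ} {F : Set X} (hJ : J F ≠ ⊤)
    (hf : IntegrableOn f F) :
    ene J f F = (((J F).toReal + ∫ x in F, f x : ℝ) : EReal) := by
  have hpos : ∫⁻ x in F, ENNReal.ofReal (f x) ≠ ⊤ := hf.lintegral_lt_top.ne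
  have hneg : ∫⁻ x in F, ENNReal.ofReal (-f x) ≠ ⊤ := hf.neg.lintegral_lt_top.ne
  rw [ene, enInt, integral_eq_lintegral_pos_part_sub_lintegral_neg_part hf]
  push_cast
  rw [EReal.coe_ennreal_toReal hJ, EReal.coe_ennreal_toReal hpos,
    EReal.coe_ennreal_toReal hneg]

theorem ene_ne_top_iff {J : Set X → ℝ≥0∞} {f : X → ℝ} {F : Set X} (hf : Measurable f)
    (hneg : ∫⁻ x, ENNReal.ofReal (-f x) ≠ ⊤) :
    ene J f F ≠ ⊤ ↔ J F ≠ ⊤ ∧ IntegrableOn f F := by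
  have hneg' : ∫⁻ x in F, ENNReal.ofReal (-f x) ≠ ⊤ :=
    ne_top_of_le_ne_top hneg (setLIntegral_le_lintegral _ _)
  refine ⟨fun htop => ?_, fun ⟨hJ, hint⟩ => ene_eq_coe hJ hint ▸ EReal.coe_ne_top _⟩
  have hbot : enInt f F ≠ ⊥ := by
    rw [enInt, ← EReal.coe_ennreal_toReal hneg']
    simp [sub_eq_add_neg, ← EReal.coe_neg, EReal.add_eq_bot_iff]
  have hJ : J F ≠ ⊤ := by
    intro hJ
    exact htop (by rw [ene, hJ, EReal.coe_ennreal_top, EReal.top_add_of_ne_bot hbot])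
  refine ⟨hJ, hf.aestronglyMeasurable, ?_⟩
  have hpos : ∫⁻ x in F, ENNReal.ofReal (f x) ≠ ⊤ := by
    intro hpos
    apply htop
    rw [ene, enInt, hpos, ← EReal.coe_ennreal_toReal hneg', EReal.coe_ennreal_top,
      EReal.top_sub_coe, EReal.add_top_of_ne_bot (EReal.coe_ennreal_ne_bot _)]
  rw [hasFiniteIntegral_iff_norm]
  calc ∫⁻ x in F, ENNReal.ofReal ‖f x‖
      ≤ ∫⁻ x in F, (ENNReal.ofReal (f x) + ENNReal.ofReal (-f x)) := by
        refine lintegral_mono fun x => ?_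
        rcases le_total 0 (f x) with h | h
        · simp [Real.norm_of_nonneg h]
        · simp [Real.norm_of_nonpos h]
    _ = (∫⁻ x in F, ENNReal.ofReal (f x)) + ∫⁻ x in F, ENNReal.ofReal (-f x) :=
        lintegral_add_left hf.ennreal_ofReal _
    _ < ⊤ := (ENNReal.add_ne_top.2 ⟨hpos, hneg'⟩).lt_top

theorem IsMinimizer.inter_union {J : Set X → ℝ≥0∞}
    (hJ : ∀ A B : Set X, MeasurableSet A → MeasurableSet B →
      J (A ∪ B) + J (A ∩ B) ≤ J A + J B)
    {f g : X → ℝ} (hf : Measurable f) (hg : Measurable g) (hfg : f ≤ g)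
    (hneg : ∫⁻ x, ENNReal.ofReal (-f x) ≠ ⊤) {A B : Set X}
    (hA : IsMinimizer (ene J g) A) (hB : IsMinimizer (ene J f) B)
    (hA_top : ene J g A ≠ ⊤) :
    IsMinimizer (ene J g) (A ∩ B) ∧ IsMinimizer (ene J f) (A ∪ B) := by
  have hneg_g : ∫⁻ x, ENNReal.ofReal (-g x) ≠ ⊤ :=
    ne_top_of_le_ne_top hneg
      (lintegral_mono fun x => ENNReal.ofReal_le_ofReal (neg_le_neg (hfg x)))
  obtain ⟨hJA, hgA⟩ := (ene_ne_top_iff hg hneg_g).1 hA_top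
  have hfA : IntegrableOn f A := by
    refine integrable_of_le_of_le (g₁ := fun x => -(ENNReal.ofReal (-f x)).toReal)
      hf.aestronglyMeasurable (.of_forall fun x => ?_) (.of_forall hfg) ?_ hgA
    · have := le_max_left (-f x) 0
      simp only [ENNReal.toReal_ofReal']
      linarith
    · exact ((integrable_toReal_of_lintegral_ne_top
        (hf.neg.ennreal_ofReal.aemeasurable) hneg).neg).integrableOn
  have hB_top : ene J f B ≠ ⊤ :=
    ne_top_of_le_ne_top ((ene_ne_top_iff hf hneg).2 ⟨hJA, hfA⟩) (hB.2 A hA.1)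
  obtain ⟨hJB, hfB⟩ := (ene_ne_top_iff hf hneg).1 hB_top
  have hsub := hJ A B hA.1 hB.1
  have hsum : J A + J B ≠ ⊤ := ENNReal.add_ne_top.2 ⟨hJA, hJB⟩
  obtain ⟨hJU, hJI⟩ := ENNReal.add_ne_top.1 (ne_top_of_le_ne_top hsum hsub)
  have hsubR := ENNReal.toReal_mono hsum hsub
  rw [ENNReal.toReal_add hJU hJI, ENNReal.toReal_add hJA hJB] at hsubR
  have hgI : IntegrableOn g (A ∩ B) := hgA.mono_set inter_subset_left
  have hfU : IntegrableOn f (A ∪ B) := hfA.union hfB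
  have hsplit_g := integral_inter_add_sdiff hB.1 hgA
  have hsplit_f : ∫ x in A ∪ B, f x = (∫ x in A \ B, f x) + ∫ x in B, f x := by
    rw [← sdiff_union_self, setIntegral_union disjoint_sdiff_left hB.1
      (hfA.mono_set sdiff_subset) hfB]
  have hmono : ∫ x in A \ B, f x ≤ ∫ x in A \ B, g x :=
    integral_mono (hfA.mono_set sdiff_subset) (hgA.mono_set sdiff_subset) hfg
  have hminA := hA.2 _ (hA.1.inter hB.1)
  have hminB := hB.2 _ (hA.1.union hB.1)
  rw [ene_eq_coe hJA hgA, ene_eq_coe hJI hgI, EReal.coe_le_coe_iff] at hminA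
  rw [ene_eq_coe hJB hfB, ene_eq_coe hJU hfU, EReal.coe_le_coe_iff] at hminB
  refine ⟨hA.of_le (hA.1.inter hB.1) ?_, hB.of_le (hA.1.union hB.1) ?_⟩
  · rw [ene_eq_coe hJA hgA, ene_eq_coe hJI hgI, EReal.coe_le_coe_iff]
    linarith
  · rw [ene_eq_coe hJB hfB, ene_eq_coe hJU hfU, EReal.coe_le_coe_iff]
    linarith

theorem setLIntegral_translate (φ : X → ℝ≥0∞) (z : X) (G : Set X) :
    ∫⁻ x in (fun x => x + z) '' G, φ (x - z) = ∫⁻ x in G, φ x := by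
  rw [← (measurePreserving_add_right volume z).setLIntegral_comp_emb
    (measurableEmbedding_addRight z)]
  simp

theorem volume_translate (z : X) (G : Set X) :
    volume ((fun x => x + z) '' G) = volume G := by
  simp

theorem measurableSet_translate {G : Set X} (hG : MeasurableSet G) (z : X) :
    MeasurableSet ((fun x => x + z) '' G) :=
  (measurableEmbedding_addRight z).measurableSet_image.2 hG

theorem translate_neg_translate (z : X) (G : Set X) :
    (fun x => x + z) '' ((fun x => x + -z) '' G) = G := by
  rw [image_image]
  simp

theorem ene_translate {J : Set X → ℝ≥0∞}
    (hJ : ∀ (A : Set X) (y : X), J ((fun x => x + y) '' A) = J A)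
    (f : X → ℝ) (z : X) (G : Set X) :
    ene J (fun x => f (x - z)) ((fun x => x + z) '' G) = ene J f G := by
  rw [ene, ene, enInt, enInt, hJ,
    setLIntegral_translate (fun x => ENNReal.ofReal (f x)),
    setLIntegral_translate (fun x => ENNReal.ofReal (-f x))]

theorem isMinimizer_translate_iff {J : Set X → ℝ≥0∞}
    (hJ : ∀ (A : Set X) (y : X), J ((fun x => x + y) '' A) = J A)
    {f : X → ℝ} {z : X} {G : Set X} :
    IsMinimizer (ene J (fun x => f (x - z))) ((fun x => x + z) '' G) ↔
      IsMinimizer (ene J f) G := by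
  have key : ∀ H, ene J (fun x => f (x - z)) H = ene J f ((fun x => x + -z) '' H) := by
    intro H
    conv_lhs => rw [← translate_neg_translate z H, ene_translate hJ]
  refine and_congr (measurableEmbedding_addRight z).measurableSet_image ?_
  rw [ene_translate hJ]
  refine ⟨fun hG H hH => ?_, fun hG H hH => ?_⟩
  · simpa only [ene_translate hJ] using hG _ (measurableSet_translate hH z)
  · rw [key]
    exact hG _ (measurableSet_translate hH (-z))

theorem IsMinimalMinimizer.translate {J : Set X → ℝ≥0∞}
    (hJ : ∀ (A : Set X) (y : X), J ((fun x => x + y) '' A) = J A)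
    {f : X → ℝ} {F : Set X} (hF : IsMinimalMinimizer (ene J f) F) (z : X) :
    IsMinimalMinimizer (ene J (fun x => f (x - z))) ((fun x => x + z) '' F) := by
  refine ⟨(isMinimizer_translate_iff hJ).2 hF.1, fun G hG => ?_⟩
  rw [← translate_neg_translate z G] at hG ⊢
  rw [← image_sdiff (add_left_injective z), volume_translate]
  exact hF.2 _ ((isMinimizer_translate_iff hJ).1 hG)

theorem continuous_sdist (E : Set X) : Continuous (sdist E) :=
  (Metric.continuous_infDist_pt E).sub (Metric.continuous_infDist_pt Eᶜ)

theorem infDist_le_abs_sdist (E : Set X) (x : X) : Metric.infDist x E ≤ |sdist E x| := by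
  by_cases hx : x ∈ E
  · simp [Metric.infDist_zero_of_mem hx]
  · rw [sdist, Metric.infDist_zero_of_mem (mem_compl hx), sub_zero]
    exact le_abs_self _

theorem lintegral_neg_sdist_ne_top {E : Set X} (hE : Bornology.IsBounded E) {h : ℝ}
    (hh : 0 < h) : ∫⁻ x, ENNReal.ofReal (-(sdist E x / h)) ≠ ⊤ := by
  have hcont : Continuous fun x => -(sdist E x / h) := ((continuous_sdist E).div_const h).neg
  have hsupp : Function.support (fun x => ENNReal.ofReal (-(sdist E x / h))) ⊆ closure E := by
    intro x hx
    by_contra hxE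
    have hxE' : x ∈ Eᶜ := fun h => hxE (subset_closure h)
    refine hx (ENNReal.ofReal_of_nonpos (neg_nonpos.2 (div_nonneg ?_ hh.le)))
    rw [sdist, Metric.infDist_zero_of_mem hxE', sub_zero]
    exact Metric.infDist_nonneg
  rw [← setLIntegral_eq_of_support_subset hsupp]
  exact (hcont.continuousOn.integrableOn_compact hE.isCompact_closure).lintegral_lt_top.ne

theorem sdist_le_sdist_sub {E E' : Set X} (hE : E.Nonempty) (hE' : E'ᶜ.Nonempty) {z : X}
    (hz : (fun x => x + z) '' E ⊆ E') (x : X) : sdist E' x ≤ sdist E (x - z) := by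
  refine sub_le_sub ((Metric.le_infDist hE).2 fun {y} hy => ?_)
    ((Metric.le_infDist hE').2 fun {w} hw => ?_)
  · calc Metric.infDist x E' ≤ dist x (y + z) :=
          Metric.infDist_le_dist_of_mem (hz (mem_image_of_mem _ hy))
      _ = dist (x - z) y := by rw [dist_eq_norm, dist_eq_norm]; congr 1; abel
  · have hwE : w - z ∈ Eᶜ := fun hwE => hw (by simpa using hz (mem_image_of_mem _ hwE))
    calc Metric.infDist (x - z) Eᶜ ≤ dist (x - z) (w - z) := Metric.infDist_le_dist_of_mem hwE
      _ = dist x w := dist_sub_right _ _ _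

theorem exists_sdist_sub_le {E E' : Set X} (hE : E.Nonempty)
    (hE' : Bornology.IsBounded E') {z : X} (hz : (fun x => x + z) '' E ⊆ E') :
    ∃ C, ∀ x, sdist E (x - z) ≤ |sdist E' x| + C := by
  obtain ⟨e, he⟩ := hE
  have hez : e + z ∈ E' := hz (mem_image_of_mem _ he)
  refine ⟨Metric.diam E', fun x => ?_⟩
  suffices Metric.infDist (x - z) E - Metric.diam E' ≤ Metric.infDist x E' by
    have h₁ := infDist_le_abs_sdist E' x
    have h₂ : 0 ≤ Metric.infDist (x - z) Eᶜ := Metric.infDist_nonneg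
    rw [sdist]
    linarith
  refine (Metric.le_infDist ⟨_, hez⟩).2 fun {y} hy => ?_
  have h₁ := Metric.infDist_le_dist_of_mem (x := x - z) he
  have h₂ : dist (x - z) e = dist x (e + z) := by
    rw [dist_eq_norm, dist_eq_norm]; congr 1; abel
  have h₃ := dist_triangle x y (e + z)
  have h₄ := Metric.dist_le_diam_of_mem hE' hy hez
  linarith

theorem volume_ne_top_of_integrableOn_sdist {E B : Set X} (hEne : E.Nonempty)
    (hE : Bornology.IsBounded E) (hB : MeasurableSet B) (hint : IntegrableOn (sdist E) B) :
    volume B ≠ ⊤ := by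
  have h₁ : volume ({x | 1 ≤ ‖sdist E x‖} ∩ B) < ⊤ := by
    rw [← Measure.restrict_apply' hB]
    exact Integrable.measure_norm_ge_lt_top hint one_pos
  have h₂ : volume (Metric.thickening 1 E) < ⊤ := hE.thickening.measure_lt_top
  refine ne_top_of_le_ne_top (ENNReal.add_ne_top.2 ⟨h₁.ne, h₂.ne⟩)
    ((measure_mono fun x hx => ?_).trans (measure_union_le _ _))
  by_cases hx1 : 1 ≤ ‖sdist E x‖
  · exact Or.inl ⟨hx1, hx⟩
  · refine Or.inr ((Metric.mem_thickening_iff_infDist_lt hEne).2 ?_)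
    exact (infDist_le_abs_sdist E x).trans_lt (not_le.1 hx1)

theorem integrableOn_sdist_sub {E E' B : Set X} (hE : E.Nonempty) (hE'ne : E'.Nonempty)
    (hE'c : E'ᶜ.Nonempty) (hE' : Bornology.IsBounded E') {z : X}
    (hz : (fun x => x + z) '' E ⊆ E') (hB : MeasurableSet B)
    (hint : IntegrableOn (sdist E') B) : IntegrableOn (fun x => sdist E (x - z)) B := by
  obtain ⟨C, hC⟩ := exists_sdist_sub_le hE hE' hz
  refine integrable_of_le_of_le
    ((continuous_sdist E).comp (continuous_sub_right z)).aestronglyMeasurable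
    (.of_forall (sdist_le_sdist_sub hE hE'c hz)) (.of_forall hC) hint ?_
  exact hint.abs.add
    (integrableOn_const (volume_ne_top_of_integrableOn_sdist hE'ne hE' hB hint))

end Comparison

/-- **translated comparison for the discrete scheme.** If `J` is submodular
and translation invariant and `E + z ⊆ E'` for all `|z| ≤ R`, then every translate by
`|z| ≤ R` of the minimal (resp. maximal) minimizer of the incremental problem for `E` is
contained, up to a null set, in the minimal (resp. maximal) minimizer for `E'`. -/
theorem stmt7 (N : ℕ) (hN : 1 ≤ N)
    (J : Set (EuclideanSpace ℝ (Fin N)) → ℝ≥0∞)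
    (hJsub : ∀ A B : Set (EuclideanSpace ℝ (Fin N)), MeasurableSet A → MeasurableSet B →
      J (A ∪ B) + J (A ∩ B) ≤ J A + J B)
    (hJtrans : ∀ (A : Set (EuclideanSpace ℝ (Fin N))) (y : EuclideanSpace ℝ (Fin N)),
      J ((fun x => x + y) '' A) = J A)
    (R : ℝ) (hR : 0 < R)
    (E E' : Set (EuclideanSpace ℝ (Fin N)))
    (hEne : E.Nonempty) (hE'ne : E'.Nonempty)
    (hEbd : Bornology.IsBounded E) (hE'bd : Bornology.IsBounded E')
    (hEE' : ∀ z : EuclideanSpace ℝ (Fin N), ‖z‖ ≤ R → (fun x => x + z) '' E ⊆ E')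
    (h : ℝ) (hh : 0 < h) :
    (∀ F F' : Set (EuclideanSpace ℝ (Fin N)),
      IsMinimalMinimizer (ene J (fun x => sdist E x / h)) F →
      IsMinimalMinimizer (ene J (fun x => sdist E' x / h)) F' →
      ∀ z : EuclideanSpace ℝ (Fin N), ‖z‖ ≤ R →
        volume (((fun x => x + z) '' F) \ F') = 0) ∧
    (∀ F F' : Set (EuclideanSpace ℝ (Fin N)),
      IsMaximalMinimizer (ene J (fun x => sdist E x / h)) F →
      IsMaximalMinimizer (ene J (fun x => sdist E' x / h)) F' →
      ∀ z : EuclideanSpace ℝ (Fin N), ‖z‖ ≤ R →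
        volume (((fun x => x + z) '' F) \ F') = 0) := by
  have : Nonempty (Fin N) := ⟨⟨0, hN⟩⟩
  have hE'c : E'ᶜ.Nonempty := by
    rw [nonempty_compl]
    rintro rfl
    exact NormedSpace.unbounded_univ ℝ _ hE'bd
  have hneg := lintegral_neg_sdist_ne_top hE'bd hh
  have hmeas : Measurable fun x => sdist E' x / h :=
    ((continuous_sdist E').div_const h).measurable
  have hmeas_z (z : EuclideanSpace ℝ (Fin N)) : Measurable fun x => sdist E (x - z) / h :=
    (((continuous_sdist E).comp (continuous_sub_right z)).div_const h).measurable
  have hle (z : EuclideanSpace ℝ (Fin N)) (hz : ‖z‖ ≤ R) :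
      (fun x => sdist E' x / h) ≤ fun x => sdist E (x - z) / h := fun x =>
    div_le_div_of_nonneg_right (sdist_le_sdist_sub hEne hE'c (hEE' z hz) x) hh.le
  refine ⟨fun F F' hF hF' z hz => ?_, fun F F' hF hF' z hz => ?_⟩
  · have hFz := hF.translate hJtrans z
    by_cases htop : ene J (fun x => sdist E (x - z) / h) ((fun x => x + z) '' F) = ⊤
    · have h0 := hFz.2 ∅ (hFz.1.of_eq_top .empty htop)
      exact measure_mono_null sdiff_subset (by simpa only [sdiff_empty] using h0)
    · have hmin := (hFz.1.inter_union hJsub hmeas (hmeas_z z) (hle z hz) hneg hF'.1 htop).1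
      simpa only [sdiff_self_inter] using hFz.2 _ hmin
  · have hFz := (isMinimizer_translate_iff (f := fun x => sdist E x / h) (z := z) hJtrans).2 hF.1
    by_cases htop' : ene J (fun x => sdist E' x / h) F' = ⊤
    · exact measure_mono_null (sdiff_subset_sdiff_left (subset_univ _))
        (hF'.2 univ (hF'.1.of_eq_top .univ htop'))
    · obtain ⟨hJF', hint⟩ := (ene_ne_top_iff hmeas hneg).1 htop'
      have hint' : IntegrableOn (sdist E') F' := by
        simpa [IntegrableOn, hh.ne'] using hint.mul_const h
      have hint_z := (integrableOn_sdist_sub hEne hE'ne hE'c hE'bd (hEE' z hz)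
        hF'.1.1 hint').div_const h
      have htop : ene J (fun x => sdist E (x - z) / h) ((fun x => x + z) '' F) ≠ ⊤ :=
        ne_top_of_le_ne_top (ene_eq_coe hJF' hint_z ▸ EReal.coe_ne_top _)
          (hFz.2 F' hF'.1.1)
      have hmin := (hFz.inter_union hJsub hmeas (hmeas_z z) (hle z hz) hneg hF'.1 htop).2
      simpa only [union_sdiff_right] using hF'.2 _ hmin
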